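/- Compatibility of the transition system with ⪯: if Θ and Θ' are finite sets of extended configurations such that Θ ≤min Θ', and θ' is an extended configuration with Θ' ⟹ θ', then there exists an extended configuration θ with θ ⪯ θ' and Θ^∼ ⟹ⁿ θ, for some n bounded by a computable function of Θ. -/

import Mathlib

namespace ECBUDA

/-- Evaluation of a nonempty word under the semigroup homomorphism determined
by the letter map `h` (and `none` on the empty word). -/
def hword {A B S : Type} [Mul S] (h : A × B → S) : List (A × B) → Option S
  | [] => none
  | c :: w => some (w.foldl (fun s x => s * h x) (h c))

/-- (NF1): the homomorphism takes distinct values on words of length one: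
`h(w) = h(c)` iff `w = c`. -/
def NF1 {A B S : Type} [Mul S] (h : A × B → S) : Prop :=
  ∀ (w : List (A × B)) (c : A × B), hword h w = some (h c) ↔ w = [c]

/-- Basic tests allowed in normal form (NF2): state tests, `⟨μ⟩^=`, `⟨μ⟩^≠`
and `root`. -/
inductive NTest (Q S : Type) : Type where
  | state : Q → NTest Q S
  | deq : S → NTest Q S
  | dneq : S → NTest Q S
  | root : NTest Q S

/-- Basic actions. -/
inductive NAct (Q : Type) : Type where
  | accept : NAct Q
  | keep : Q → NAct Q
  | store : Q → NAct Q
  | guess : Q → NAct Q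
  | univ : Q → NAct Q

/-- The set `TA`: possibly negated basic tests (the Boolean flag `true` marks
negation), basic actions, and the three symbols `⊤`, `⊤g`, `⊥`. -/
inductive TA (Q S : Type) : Type where
  | test : Bool → NTest Q S → TA Q S
  | act : NAct Q → TA Q S
  | top : TA Q S
  | topg : TA Q S
  | bot : TA Q S

/-- A transition of the automaton in normal form: a conjunction of possibly
negated basic tests with a conjunction of basic actions. -/
abbrev NTrans (Q S : Type) : Type := List (Bool × NTest Q S) × List (NAct Q)

/-- An extended configuration `(Δ, Γ, r, m)`: `Δ` a finite set of threads,
`Γ` a finite set of pairs (semigroup element, data value) containing exactly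
one pair whose first component is the image under `h` of a letter (this letter
is the label of the configuration and the associated data value its data
value), and Booleans `r` (root) and `m` (merge). -/
structure EConf (A B Q S : Type) (D : Type) (h : A × B → S) : Type where
  Δ : Set (Q × TA Q S × D)
  Γ : Set (S × D)
  r : Bool
  m : Bool
  finΔ : Δ.Finite
  finΓ : Γ.Finite
  uniq : ∃! x : S × D, x ∈ Γ ∧ ∃ c : A × B, x.1 = h c

variable {A B Q S D : Type} {h : A × B → S}

/-- `Δ(d)`: the threads carrying the data value `d`. -/
def EConf.dfun (θ : EConf A B Q S D h) (d : D) : Set (Q × TA Q S) :=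
  {qa | (qa.1, qa.2, d) ∈ θ.Δ}

/-- `Γ(d)`: the semigroup elements of downward paths leading to `d`. -/
def EConf.gfun (θ : EConf A B Q S D h) (d : D) : Set S :=
  {μ | (μ, d) ∈ θ.Γ}

/-- The data values occurring in the extended configuration. -/
def EConf.dataset (θ : EConf A B Q S D h) : Set D :=
  {d | (∃ qa : Q × TA Q S, (qa.1, qa.2, d) ∈ θ.Δ) ∨ ∃ μ : S, (μ, d) ∈ θ.Γ}

/-- The unique pair of `Γ` recording the label and the data value of the root. -/
def EConf.rootInfo (θ : EConf A B Q S D h) : Set (S × D) :=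
  {x ∈ θ.Γ | ∃ c : A × B, x.1 = h c}

/-- The set of data values of the root pair (a singleton). -/
def EConf.rootData (θ : EConf A B Q S D h) : Set D :=
  {d | ∃ μ : S, (μ, d) ∈ θ.Γ ∧ ∃ c : A × B, μ = h c}

/-- The profile `(A₀, A₁, r, m)` of an extended configuration: `Aᵢ` is the set
of those `χ ⊆ S` such that exactly `i` data values `d` satisfy `Γ(d) = χ`. -/
def EConf.profile (θ : EConf A B Q S D h) :
    Set (Set S) × Set (Set S) × Bool × Bool :=
  ({χ | {d | θ.gfun d = χ}.encard = 0},
   {χ | {d | θ.gfun d = χ}.encard = 1}, θ.r, θ.m)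

/-- `θ₁ ⪯_f θ₂`. -/
def pleF (f : D → D) (θ₁ θ₂ : EConf A B Q S D h) : Prop :=
  θ₁.profile = θ₂.profile ∧ θ₁.dataset ⊆ Set.range f ∧
  ∀ d : D, θ₁.dfun (f d) ⊆ θ₂.dfun d ∧ θ₁.gfun (f d) = θ₂.gfun d

/-- The well-quasi-order `⪯` on extended configurations. -/
def ple (θ₁ θ₂ : EConf A B Q S D h) : Prop :=
  ∃ f : D → D, pleF f θ₁ θ₂

/-- `θ₁ ∼ θ₂`: equal up to a bijection of the data values. -/
def simEquiv (θ₁ θ₂ : EConf A B Q S D h) : Prop :=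
  ∃ g : D ≃ D,
    θ₂.Δ = {x | (x.1, x.2.1, g.symm x.2.2) ∈ θ₁.Δ} ∧
    θ₂.Γ = {x | (x.1, g.symm x.2) ∈ θ₁.Γ} ∧
    θ₂.r = θ₁.r ∧ θ₂.m = θ₁.m

/-- The closure of a set of extended configurations under `∼`. -/
def simClose (Θ : Set (EConf A B Q S D h)) : Set (EConf A B Q S D h) :=
  {θ | ∃ θ' ∈ Θ, simEquiv θ θ'}

/-- `Θ ≤min Θ'`: every member of `Θ'` is minorized by a member of `Θ`. -/
def leMin (Θ Θ' : Set (EConf A B Q S D h)) : Prop :=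
  ∀ θ' ∈ Θ', ∃ θ ∈ Θ, ple θ θ'

/-- Satisfaction of a basic test by the thread `(q, d)` in an extended
configuration. -/
def ntestHolds (θ : EConf A B Q S D h) (q : Q) (d : D) : NTest Q S → Prop
  | .state p => q = p
  | .deq μ => (μ, d) ∈ θ.Γ
  | .dneq μ => ∃ e : D, e ≠ d ∧ (μ, e) ∈ θ.Γ
  | .root => θ.r = true

def taTestHolds (θ : EConf A B Q S D h) (q : Q) (d : D) (neg : Bool)
    (t : NTest Q S) : Prop :=
  if neg then ¬ ntestHolds θ q d t else ntestHolds θ q d t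

/-- The tests and actions occurring in a transition, as elements of `TA`. -/
def taSet (tr : NTrans Q S) : Set (TA Q S) :=
  {x | (∃ nt ∈ tr.1, x = TA.test nt.1 nt.2) ∨ ∃ a ∈ tr.2, x = TA.act a}

/-- The ε-transitions of the transition system: they keep `Γ`, `r` (hence the
label and data value), require the merge flag to be false, and rewrite one
thread of `Δ`. -/
def epsStep (δ : List (NTrans Q S)) (θ₁ θ₂ : EConf A B Q S D h) : Prop :=
  θ₁.m = false ∧ θ₂.m = false ∧ θ₂.r = θ₁.r ∧ θ₂.Γ = θ₁.Γ ∧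
  ∃ (q : Q) (d : D),
    -- applying a transition of δ to a ⊥-thread
    ((∃ tr ∈ δ, (q, TA.bot, d) ∈ θ₁.Δ ∧
        θ₂.Δ = (θ₁.Δ \ {(q, TA.bot, d)}) ∪
          {x | x.1 = q ∧ x.2.2 = d ∧ x.2.1 ∈ taSet tr}) ∨
    -- univ
    (∃ p : Q, (q, TA.act (NAct.univ p), d) ∈ θ₁.Δ ∧
        θ₂.Δ = (θ₁.Δ \ {(q, TA.act (NAct.univ p), d)}) ∪
          {x | x.1 = p ∧ x.2.1 = TA.top ∧ ∃ μ : S, (μ, x.2.2) ∈ θ₁.Γ}) ∨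
    -- guess
    (∃ (p : Q) (d' : D), (q, TA.act (NAct.guess p), d) ∈ θ₁.Δ ∧
        θ₂.Δ = (θ₁.Δ \ {(q, TA.act (NAct.guess p), d)}) ∪ {(p, TA.topg, d')}) ∨
    -- store
    (∃ (p : Q) (d' : D), (q, TA.act (NAct.store p), d) ∈ θ₁.Δ ∧
        d' ∈ θ₁.rootData ∧
        θ₂.Δ = (θ₁.Δ \ {(q, TA.act (NAct.store p), d)}) ∪ {(p, TA.top, d')}) ∨
    -- keep
    (∃ p : Q, (q, TA.act (NAct.keep p), d) ∈ θ₁.Δ ∧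
        θ₂.Δ = (θ₁.Δ \ {(q, TA.act (NAct.keep p), d)}) ∪ {(p, TA.top, d)}) ∨
    -- accept
    ((q, TA.act NAct.accept, d) ∈ θ₁.Δ ∧
        θ₂.Δ = θ₁.Δ \ {(q, TA.act NAct.accept, d)}) ∨
    -- a (possibly negated) basic test, deleted if it holds
    (∃ (neg : Bool) (t : NTest Q S), (q, TA.test neg t, d) ∈ θ₁.Δ ∧
        taTestHolds θ₁ q d neg t ∧
        θ₂.Δ = θ₁.Δ \ {(q, TA.test neg t, d)}))

/-- The transition `→inc(S, χ)`. -/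
def incStep (Sq : Set (Q × TA Q S)) (χ : Set S) (θ₁ θ₂ : EConf A B Q S D h) :
    Prop :=
  (∃ d : D, θ₁.dfun d = Sq ∧ θ₁.gfun d = χ) ∧
  (∃ e₁ e₂ : D, e₁ ≠ e₂ ∧ θ₁.gfun e₁ = χ ∧ θ₁.gfun e₂ = χ) ∧
  ∃ e : D, e ∉ θ₁.dataset ∧ θ₂.r = θ₁.r ∧ θ₂.m = θ₁.m ∧
    (∀ d : D, d ≠ e → θ₂.dfun d = θ₁.dfun d ∧ θ₂.gfun d = θ₁.gfun d) ∧
    θ₂.dfun e = {qa ∈ Sq | qa.2 ≠ TA.topg} ∧ θ₂.gfun e = χ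

/-- The transition `→inc`. -/
def inc (θ₁ θ₂ : EConf A B Q S D h) : Prop :=
  ∃ (Sq : Set (Q × TA Q S)) (χ : Set S), incStep Sq χ θ₁ θ₂

/-- The transition `→grow`, adding a new root on top. -/
def growStep [Semigroup S] (θ₁ θ₂ : EConf A B Q S D h) : Prop :=
  θ₁.r = false ∧ θ₁.m = false ∧
  (∀ x ∈ θ₁.Δ, x.2.1 = TA.top ∨ x.2.1 = TA.topg) ∧
  θ₂.Δ = {x | x.2.1 = TA.bot ∧ ∃ α : TA Q S, (x.1, α, x.2.2) ∈ θ₁.Δ} ∧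
  ∃ (c : A × B) (d' : D),
    θ₂.Γ = {y | ∃ μ : S, ∃ e : D, (μ, e) ∈ θ₁.Γ ∧ y = (h c * μ, e)} ∪ {(h c, d')}

/-- The transition `→merge`, merging two extended configurations with the same
label and data value. -/
def mergeStep (θ₁ θ₂ θ₀ : EConf A B Q S D h) : Prop :=
  θ₁.rootInfo = θ₂.rootInfo ∧ θ₀.rootInfo = θ₁.rootInfo ∧
  θ₁.m = true ∧ θ₂.m = true ∧ θ₀.r = θ₁.r ∧ θ₁.r = θ₂.r ∧
  θ₀.Δ = θ₁.Δ ∪ θ₂.Δ ∧ θ₀.Γ = θ₁.Γ ∪ θ₂.Γ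

/-- Any single (ε-, inc- or grow-) transition step of the transition system. -/
def anyStep [Semigroup S] (δ : List (NTrans Q S)) (θ₁ θ₂ : EConf A B Q S D h) :
    Prop :=
  epsStep δ θ₁ θ₂ ∨ inc θ₁ θ₂ ∨ growStep θ₁ θ₂

/-- `Θ ⟹ θ`: one derivation step from a set of extended configurations. -/
def stepFrom [Semigroup S] (δ : List (NTrans Q S))
    (Θ : Set (EConf A B Q S D h)) (θ : EConf A B Q S D h) : Prop :=
  (∃ θ₁ ∈ Θ, anyStep δ θ₁ θ) ∨ ∃ θ₁ ∈ Θ, ∃ θ₂ ∈ Θ, mergeStep θ₁ θ₂ θ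

/-- `Θ ⟹⁺ θ`. -/
inductive Derives [Semigroup S] (δ : List (NTrans Q S)) :
    Set (EConf A B Q S D h) → EConf A B Q S D h → Prop where
  | base {Θ : Set (EConf A B Q S D h)} {θ : EConf A B Q S D h} :
      stepFrom δ Θ θ → Derives δ Θ θ
  | step {Θ : Set (EConf A B Q S D h)} {θ' θ : EConf A B Q S D h} :
      stepFrom δ Θ θ' → Derives δ (Θ ∪ {θ'}) θ → Derives δ Θ θ

/-- `Θ ⟹ⁿ θ`: derivation in at most `n` steps. -/
inductive DerivesN [Semigroup S] (δ : List (NTrans Q S)) :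
    ℕ → Set (EConf A B Q S D h) → EConf A B Q S D h → Prop where
  | base {n : ℕ} {Θ : Set (EConf A B Q S D h)} {θ : EConf A B Q S D h} :
      stepFrom δ Θ θ → DerivesN δ (n + 1) Θ θ
  | step {n : ℕ} {Θ : Set (EConf A B Q S D h)} {θ' θ : EConf A B Q S D h} :
      stepFrom δ Θ θ' → DerivesN δ n (Θ ∪ {θ'}) θ → DerivesN δ (n + 1) Θ θ

/-- `n`-fold composition of a binary relation. -/
def relPow {α : Type} (R : α → α → Prop) : ℕ → α → α → Prop
  | 0 => Eq
  | n + 1 => fun a c => ∃ b, R a b ∧ relPow R n b c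

/-- An initial extended configuration (abstracting a leaf). -/
def Initial (q0 : Q) (θ : EConf A B Q S D h) : Prop :=
  (∃ d : D, θ.Δ = {(q0, TA.bot, d)}) ∧
  ∃ (c : A × B) (d' : D), θ.Γ = {(h c, d')}

/-- An accepting extended configuration: no remaining threads. -/
def Accepting (θ : EConf A B Q S D h) : Prop := θ.Δ = ∅

section Proof

theorem mem_dfun (θ : EConf A B Q S D h) (q : Q) (α : TA Q S) (d : D) :
    (q, α) ∈ θ.dfun d ↔ (q, α, d) ∈ θ.Δ := Iff.rfl

theorem mem_gfun (θ : EConf A B Q S D h) (μ : S) (d : D) :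
    μ ∈ θ.gfun d ↔ (μ, d) ∈ θ.Γ := Iff.rfl

theorem dataset_finite (θ : EConf A B Q S D h) : θ.dataset.Finite := by
  refine ((θ.finΔ.image (fun x => x.2.2)).union (θ.finΓ.image (fun x => x.2))).subset ?_
  rintro d (⟨qa, hq⟩ | ⟨μ, hμ⟩)
  · exact Or.inl ⟨_, hq, rfl⟩
  · exact Or.inr ⟨_, hμ, rfl⟩

theorem gfun_empty {θ : EConf A B Q S D h} {d : D} (hd : d ∉ θ.dataset) : θ.gfun d = ∅ := by
  ext μ
  simp only [Set.mem_empty_iff_false, iff_false]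
  exact fun hm => hd (Or.inr ⟨μ, hm⟩)

theorem dfun_empty {θ : EConf A B Q S D h} {d : D} (hd : d ∉ θ.dataset) : θ.dfun d = ∅ := by
  ext qa
  simp only [Set.mem_empty_iff_false, iff_false]
  exact fun hm => hd (Or.inl ⟨qa, hm⟩)

theorem notMem_dataset {θ : EConf A B Q S D h} {d : D} (h1 : θ.dfun d = ∅) (h2 : θ.gfun d = ∅) :
    d ∉ θ.dataset := by
  rintro (⟨qa, hq⟩ | ⟨μ, hμ⟩)
  · have : qa ∈ θ.dfun d := hq
    rw [h1] at this; exact this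
  · have : μ ∈ θ.gfun d := hμ
    rw [h2] at this; exact this

theorem exists_two_fresh [Infinite D] (θ : EConf A B Q S D h) :
    ∃ e₁ e₂ : D, e₁ ≠ e₂ ∧ e₁ ∉ θ.dataset ∧ e₂ ∉ θ.dataset := by
  obtain ⟨e₁, h1⟩ := (dataset_finite θ).exists_notMem
  obtain ⟨e₂, h2⟩ := ((dataset_finite θ).insert e₁).exists_notMem
  simp only [Set.mem_insert_iff, not_or] at h2
  exact ⟨e₁, e₂, fun hh => h2.1 hh.symm, h1, h2.2⟩

theorem pleF_two {f : D → D} {θ θ' : EConf A B Q S D h} (hf : pleF f θ θ') {d₁ d₂ : D}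
    (hne : d₁ ≠ d₂) {χ : Set S} (h1 : θ'.gfun d₁ = χ) (h2 : θ'.gfun d₂ = χ) :
    ∃ e₁ e₂, e₁ ≠ e₂ ∧ θ.gfun e₁ = χ ∧ θ.gfun e₂ = χ := by
  have hp := hf.1
  simp only [EConf.profile, Prod.mk.injEq] at hp
  obtain ⟨p0, p1, -, -⟩ := hp
  have q0 := Set.ext_iff.1 p0 χ
  have q1 := Set.ext_iff.1 p1 χ
  simp only [Set.mem_ofPred_eq, Set.encard_eq_zero, Set.encard_eq_one] at q0 q1
  have hX : {d | θ.gfun d = χ}.Nonempty := by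
    rw [Set.nonempty_iff_ne_empty]
    intro he
    have := q0.1 he
    have hm : d₁ ∈ {d | θ'.gfun d = χ} := h1
    rw [this] at hm; exact hm
  obtain ⟨x, hx⟩ := hX
  by_contra hcon
  push Not at hcon
  have : ∃ x, {d | θ.gfun d = χ} = {x} := by
    refine ⟨x, ?_⟩
    ext y
    constructor
    · intro hy
      by_contra hyx
      exact hcon y x hyx hy hx
    · rintro rfl; exact hx
  obtain ⟨z, hz⟩ := q1.1 this
  have a1 : d₁ ∈ ({z} : Set D) := hz ▸ h1
  have a2 : d₂ ∈ ({z} : Set D) := hz ▸ h2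
  exact hne (a1.trans a2.symm)

theorem profile_of [Infinite D] {ρ : D → D} {θ θ' : EConf A B Q S D h} (hr : θ.r = θ'.r)
    (hm : θ.m = θ'.m) (hd : θ.dataset ⊆ Set.range ρ) (hg : ∀ d, θ.gfun (ρ d) = θ'.gfun d)
    (h2 : ∀ d₁ d₂, d₁ ≠ d₂ → θ'.gfun d₁ = θ'.gfun d₂ →
      ∃ e₁ e₂, e₁ ≠ e₂ ∧ θ.gfun e₁ = θ'.gfun d₁ ∧ θ.gfun e₂ = θ'.gfun d₁) :
    θ.profile = θ'.profile := by
  obtain ⟨w₁, w₂, hw, hw1, hw2⟩ := exists_two_fresh θ'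
  have hne : ∀ χ, {d | θ.gfun d = χ}.Nonempty ↔ {d | θ'.gfun d = χ}.Nonempty := by
    intro χ
    constructor
    · rintro ⟨x, hx⟩
      by_cases hxd : x ∈ θ.dataset
      · obtain ⟨y, rfl⟩ := hd hxd
        exact ⟨y, (hg y).symm.trans hx⟩
      · have := gfun_empty hxd
        exact ⟨w₁, (gfun_empty hw1).trans (this.symm.trans hx)⟩
    · rintro ⟨x, hx⟩
      exact ⟨ρ x, (hg x).trans hx⟩
  have hss : ∀ χ, {d | θ.gfun d = χ}.Subsingleton ↔ {d | θ'.gfun d = χ}.Subsingleton := by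
    intro χ
    constructor
    · intro hs x hx y hy
      by_contra hxy
      obtain ⟨e₁, e₂, hee, k1, k2⟩ := h2 x y hxy (hx.trans hy.symm)
      exact hee (hs (k1.trans hx) (k2.trans hx))
    · intro hs x hx y hy
      by_cases hχ : χ = ∅
      · exact absurd (hs ((gfun_empty hw1).trans hχ.symm) ((gfun_empty hw2).trans hχ.symm)) hw
      · have hx' : x ∈ θ.dataset := by
          by_contra hc; exact hχ (hx.symm.trans (gfun_empty hc))
        have hy' : y ∈ θ.dataset := by
          by_contra hc; exact hχ (hy.symm.trans (gfun_empty hc))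
        obtain ⟨x, rfl⟩ := hd hx'
        obtain ⟨y, rfl⟩ := hd hy'
        rw [hs ((hg x).symm.trans hx) ((hg y).symm.trans hy)]
  simp only [EConf.profile, hr, hm, Prod.mk.injEq, and_true]
  constructor
  · ext χ
    simp only [Set.mem_ofPred_eq, Set.encard_eq_zero]
    rw [← Set.not_nonempty_iff_eq_empty, ← Set.not_nonempty_iff_eq_empty, hne]
  · ext χ
    simp only [Set.mem_ofPred_eq, Set.encard_eq_one]
    rw [Set.exists_eq_singleton_iff_nonempty_subsingleton,
      Set.exists_eq_singleton_iff_nonempty_subsingleton, hne, hss]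

theorem root_unique {θ : EConf A B Q S D h} {μ ν : S} {d e : D} (h1 : (μ, d) ∈ θ.Γ)
    (c1 : ∃ c, μ = h c) (h2 : (ν, e) ∈ θ.Γ) (c2 : ∃ c, ν = h c) : μ = ν ∧ d = e := by
  have := θ.uniq.unique (y₁ := (μ, d)) (y₂ := (ν, e)) ⟨h1, c1⟩ ⟨h2, c2⟩
  simpa using this

/-- A finite set of representatives, two for each nontrivial class of `κ`. -/
structure Retr {K : Type} (κ : D → K) (E : Set D) (ρ : D → D) : Prop where
  fin : E.Finite
  card : E.ncard ≤ 2 * (Set.range κ).ncard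
  mem : ∀ e, ρ e ∈ E
  fix : ∀ e ∈ E, ρ e = e
  inv : ∀ e, κ (ρ e) = κ e
  two : ∀ e₁ e₂, e₁ ≠ e₂ → κ e₁ = κ e₂ →
    ∃ e₃ e₄, e₃ ≠ e₄ ∧ e₃ ∈ E ∧ e₄ ∈ E ∧ κ e₃ = κ e₁ ∧ κ e₄ = κ e₁

theorem exists_retr {K : Type} (κ : D → K) (hκ : (Set.range κ).Finite) :
    ∃ E ρ, Retr κ E ρ := by
  classical
  rcases isEmpty_or_nonempty D with hD | hD
  · exact ⟨∅, id, Set.finite_empty, by simp, fun e => hD.elim e, fun e => hD.elim e,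
      fun e => hD.elim e, fun e => hD.elim e⟩
  have hr1 : ∀ k : K, ∃ r : D, (∃ e, κ e = k) → κ r = k := by
    intro k
    by_cases hk : ∃ e, κ e = k
    · obtain ⟨e, he⟩ := hk; exact ⟨e, fun _ => he⟩
    · exact ⟨hD.some, fun hh => absurd hh hk⟩
  choose r1 hr1 using hr1
  have hr2 : ∀ k : K, ∃ r : D, ((∃ e, κ e = k) → κ r = k) ∧
      ((∃ e, κ e = k ∧ e ≠ r1 k) → r ≠ r1 k) := by
    intro k
    by_cases hk : ∃ e, κ e = k ∧ e ≠ r1 k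
    · obtain ⟨e, he, he'⟩ := hk; exact ⟨e, fun _ => he, fun _ => he'⟩
    · exact ⟨r1 k, hr1 k, fun hh => absurd hh hk⟩
  choose r2 hr2 hr2' using hr2
  have hm1 : ∀ e, r1 (κ e) ∈ r1 '' Set.range κ := fun e => ⟨_, ⟨e, rfl⟩, rfl⟩
  have hm2 : ∀ e, r2 (κ e) ∈ r2 '' Set.range κ := fun e => ⟨_, ⟨e, rfl⟩, rfl⟩
  refine ⟨r1 '' Set.range κ ∪ r2 '' Set.range κ,
    fun e => if e ∈ r1 '' Set.range κ ∪ r2 '' Set.range κ then e else r1 (κ e),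
    (hκ.image _).union (hκ.image _), ?_, ?_, ?_, ?_, ?_⟩
  · have h1 := Set.ncard_image_le (f := r1) hκ
    have h2 := Set.ncard_image_le (f := r2) hκ
    have h3 := Set.ncard_union_le (r1 '' Set.range κ) (r2 '' Set.range κ)
    omega
  · intro e
    split_ifs with hh
    · exact hh
    · exact Or.inl (hm1 e)
  · intro e he
    simp only [if_pos he]
  · intro e
    split_ifs with hh
    · rfl
    · exact hr1 _ ⟨e, rfl⟩
  · intro e₁ e₂ hne hk
    refine ⟨r1 (κ e₁), r2 (κ e₁), ?_, Or.inl (hm1 _), Or.inr (hm2 _), hr1 _ ⟨_, rfl⟩,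
      hr2 _ ⟨_, rfl⟩⟩
    refine (hr2' _ ?_).symm
    by_cases he : e₁ = r1 (κ e₁)
    · exact ⟨e₂, hk.symm, fun hh => hne (he.trans hh.symm)⟩
    · exact ⟨e₁, rfl, he⟩

/-- The general way of building a configuration below `θ'`. -/
theorem build [Infinite D] {K : Type} {κ : D → K} {E : Set D} {ρ : D → D} (hR : Retr κ E ρ)
    (θ' : EConf A B Q S D h) (hΓ : ∀ e e', κ e = κ e' → θ'.gfun e = θ'.gfun e')
    (Δ₂ : Set (Q × TA Q S × D)) (Γ₂ : Set (S × D))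
    (hΔr : ∀ x ∈ Δ₂, x.2.2 ∈ Set.range ρ) (hΓr : ∀ x ∈ Γ₂, x.2 ∈ Set.range ρ)
    (hΔ : ∀ q α e, (q, α, ρ e) ∈ Δ₂ → (q, α, e) ∈ θ'.Δ)
    (hΓ₂ : ∀ μ e, (μ, ρ e) ∈ Γ₂ ↔ (μ, e) ∈ θ'.Γ) :
    ∃ θ : EConf A B Q S D h, θ.Δ = Δ₂ ∧ θ.Γ = Γ₂ ∧ θ.r = θ'.r ∧ θ.m = θ'.m ∧ pleF ρ θ θ' := by
  have f1 : Δ₂.Finite := by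
    refine (θ'.finΔ.image (fun x => (x.1, x.2.1, ρ x.2.2))).subset ?_
    rintro ⟨q, α, d⟩ hx
    obtain ⟨e, rfl⟩ := hΔr _ hx
    exact ⟨_, hΔ _ _ _ hx, rfl⟩
  have f2 : Γ₂.Finite := by
    refine (θ'.finΓ.image (fun x => (x.1, ρ x.2))).subset ?_
    rintro ⟨μ, d⟩ hx
    obtain ⟨e, rfl⟩ := hΓr _ hx
    exact ⟨_, (hΓ₂ _ _).1 hx, rfl⟩
  have hu : ∃! x : S × D, x ∈ Γ₂ ∧ ∃ c : A × B, x.1 = h c := by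
    obtain ⟨⟨μ, d⟩, ⟨hm, hc⟩, -⟩ := θ'.uniq
    refine ⟨(μ, ρ d), ⟨(hΓ₂ _ _).2 hm, hc⟩, ?_⟩
    rintro ⟨ν, x⟩ ⟨hν, hc'⟩
    obtain ⟨e, rfl⟩ := hΓr _ hν
    obtain ⟨rfl, rfl⟩ := root_unique ((hΓ₂ _ _).1 hν) hc' hm hc
    rfl
  refine ⟨⟨Δ₂, Γ₂, θ'.r, θ'.m, f1, f2, hu⟩, rfl, rfl, rfl, rfl, ?_⟩
  have hd : (⟨Δ₂, Γ₂, θ'.r, θ'.m, f1, f2, hu⟩ : EConf A B Q S D h).dataset ⊆ Set.range ρ := by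
    rintro d (⟨qa, hq⟩ | ⟨μ, hμ⟩)
    · exact hΔr _ hq
    · exact hΓr _ hμ
  have hg : ∀ d, (⟨Δ₂, Γ₂, θ'.r, θ'.m, f1, f2, hu⟩ : EConf A B Q S D h).gfun (ρ d)
      = θ'.gfun d := by
    intro d; ext μ; exact hΓ₂ μ d
  refine ⟨profile_of rfl rfl hd hg ?_, hd, fun d => ⟨fun qa hq => hΔ _ _ _ hq, hg d⟩⟩
  intro d₁ d₂ hne heq
  by_cases hρ : ρ d₁ = ρ d₂
  · have hk : κ d₁ = κ d₂ := by rw [← hR.inv d₁, hρ, hR.inv]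
    obtain ⟨e₃, e₄, h34, m3, m4, k3, k4⟩ := hR.two _ _ hne hk
    refine ⟨e₃, e₄, h34, ?_, ?_⟩
    · have := hg e₃
      rw [hR.fix _ m3] at this
      rw [this, hΓ _ _ k3]
    · have := hg e₄
      rw [hR.fix _ m4] at this
      rw [this, hΓ _ _ k4]
  · exact ⟨ρ d₁, ρ d₂, hρ, hg _, (hg _).trans heq.symm⟩

/-- Extending an injection on a finite set to a permutation. -/
theorem exists_perm [Infinite D] (X : Set D) (hX : X.Finite) (s : D → D) (hs : Set.InjOn s X) :
    ∃ g : D ≃ D, ∀ x ∈ X, g x = s x := by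
  obtain ⟨g, hg⟩ := Cardinal.extend_function_of_lt (s := X)
    ⟨fun x => s x, fun x y hxy => Subtype.ext (hs x.2 y.2 hxy)⟩
    (lt_of_lt_of_le (Cardinal.lt_aleph0_iff_set_finite.2 hX) (Cardinal.aleph0_le_mk D))
    ⟨Equiv.refl D⟩
  exact ⟨g, fun x hx => hg ⟨x, hx⟩⟩

/-- The blow-up of `θ` along `φ` restricted to `V`, with originals in `E₀`. -/
def IsBlow (θ : EConf A B Q S D h) (φ : D → D) (E₀ V : Set D) (η : EConf A B Q S D h) : Prop :=
  η.Δ = {x | x.2.2 ∈ V ∧ (x.1, x.2.1, φ x.2.2) ∈ θ.Δ ∧ (x.2.1 = TA.topg → x.2.2 ∈ E₀)} ∧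
  η.Γ = {y | y.2 ∈ V ∧ (y.1, φ y.2) ∈ θ.Γ} ∧ η.r = θ.r ∧ η.m = θ.m

theorem relPow_snoc {α : Type} {R : α → α → Prop} : ∀ {n : ℕ} {a b c : α}, relPow R n a b →
    R b c → relPow R (n + 1) a c
  | 0, a, b, c, h1, h2 => by
    cases h1; exact ⟨c, h2, rfl⟩
  | n + 1, a, b, c, ⟨x, hx, hxb⟩, h2 => ⟨x, hx, relPow_snoc hxb h2⟩

theorem blow [Infinite D] (θ : EConf A B Q S D h) (φ : D → D) (E : Set D) (hE : E.Finite)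
    (hdata : θ.dataset ⊆ φ '' E)
    (htwo : ∀ e ∈ E, ∀ e' ∈ E, e ≠ e' → φ e = φ e' →
      ∃ y₁ y₂, y₁ ≠ y₂ ∧ θ.gfun y₁ = θ.gfun (φ e) ∧ θ.gfun y₂ = θ.gfun (φ e)) :
    ∃ (θ₀ η : EConf A B Q S D h) (E₀ : Set D) (k : ℕ), simEquiv θ₀ θ ∧ relPow inc k θ₀ η ∧
      k ≤ E.ncard ∧ IsBlow θ φ E₀ E η := by
  classical
  have hs : ∀ x : D, ∃ e, x ∈ θ.dataset → e ∈ E ∧ φ e = x := by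
    intro x
    by_cases hx : x ∈ θ.dataset
    · obtain ⟨e, he, rfl⟩ := hdata hx
      exact ⟨e, fun _ => ⟨he, rfl⟩⟩
    · exact ⟨x, fun hh => absurd hh hx⟩
  choose s hs using hs
  have hinj : Set.InjOn s θ.dataset := by
    intro x hx y hy hxy
    rw [← (hs x hx).2, ← (hs y hy).2, hxy]
  obtain ⟨g, hg⟩ := exists_perm θ.dataset (dataset_finite θ) s hinj
  set E₀ := s '' θ.dataset with hE₀
  have hE₀E : E₀ ⊆ E := by
    rintro _ ⟨x, hx, rfl⟩; exact (hs x hx).1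
  have hroot : ∀ e ∈ E, ∀ e' ∈ E, ∀ μ, (∃ c, μ = h c) → (μ, φ e) ∈ θ.Γ → φ e = φ e' →
      e = e' := by
    intro e he e' he' μ hc hμ hφ
    by_contra hne
    obtain ⟨y₁, y₂, hy, h1, h2⟩ := htwo e he e' he' hne hφ
    have m1 : (μ, y₁) ∈ θ.Γ := by rw [← mem_gfun, h1]; exact hμ
    have m2 : (μ, y₂) ∈ θ.Γ := by rw [← mem_gfun, h2]; exact hμ
    exact hy (root_unique m1 hc m2 hc).2
  -- existence of the blow-ups
  have hex : ∀ V : Set D, E₀ ⊆ V → V ⊆ E → ∃ η, IsBlow θ φ E₀ V η := by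
    intro V h1 h2
    have hV : V.Finite := hE.subset h2
    refine ⟨⟨{x | x.2.2 ∈ V ∧ (x.1, x.2.1, φ x.2.2) ∈ θ.Δ ∧ (x.2.1 = TA.topg → x.2.2 ∈ E₀)},
      {y | y.2 ∈ V ∧ (y.1, φ y.2) ∈ θ.Γ}, θ.r, θ.m, ?_, ?_, ?_⟩, rfl, rfl, rfl, rfl⟩
    · refine (hV.biUnion (t := fun e => (fun x : Q × TA Q S × D => (x.1, x.2.1, e)) '' θ.Δ)
        fun e _ => θ.finΔ.image _).subset ?_
      rintro ⟨q, α, e⟩ ⟨he, hm, -⟩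
      exact Set.mem_biUnion he ⟨_, hm, rfl⟩
    · refine (hV.biUnion (t := fun e => (fun x : S × D => (x.1, e)) '' θ.Γ)
        fun e _ => θ.finΓ.image _).subset ?_
      rintro ⟨μ, e⟩ ⟨he, hm⟩
      exact Set.mem_biUnion he ⟨_, hm, rfl⟩
    · obtain ⟨⟨μ, d⟩, ⟨hm, hc⟩, -⟩ := θ.uniq
      have hd : d ∈ θ.dataset := Or.inr ⟨μ, hm⟩
      have hm' : (μ, φ (s d)) ∈ θ.Γ := by rw [(hs d hd).2]; exact hm
      refine ⟨(μ, s d), ⟨⟨h1 ⟨d, hd, rfl⟩, hm'⟩, hc⟩, ?_⟩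
      rintro ⟨ν, e⟩ ⟨⟨he, hν⟩, hc'⟩
      obtain ⟨rfl, h3⟩ := root_unique hν hc' hm' hc
      rw [hroot e (h2 he) (s d) (hs d hd).1 ν hc' hν h3]
  -- the initial blow-up is equivalent to `θ`
  obtain ⟨θ₀, hθ₀⟩ := hex E₀ subset_rfl hE₀E
  have hg' : ∀ e, e ∈ E₀ → φ e = g.symm e := by
    rintro _ ⟨x, hx, rfl⟩
    rw [(hs x hx).2, ← hg x hx, Equiv.symm_apply_apply]
  have hsim : simEquiv θ₀ θ := by
    have hgE : ∀ x ∈ θ.dataset, g x ∈ E₀ := fun x hx => hg x hx ▸ ⟨x, hx, rfl⟩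
    refine ⟨g.symm, ?_, ?_, hθ₀.2.2.1.symm, hθ₀.2.2.2.symm⟩
    · rw [hθ₀.1]
      ext ⟨q, α, d⟩
      simp only [Equiv.symm_symm, Set.mem_ofPred_eq]
      constructor
      · intro hx
        have hd := hgE d (Or.inl ⟨(q, α), hx⟩)
        refine ⟨hd, ?_, fun _ => hd⟩
        rw [hg' _ hd, Equiv.symm_apply_apply]; exact hx
      · rintro ⟨h1, h2, -⟩
        rwa [hg' _ h1, Equiv.symm_apply_apply] at h2
    · rw [hθ₀.2.1]
      ext ⟨μ, d⟩
      simp only [Equiv.symm_symm, Set.mem_ofPred_eq]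
      constructor
      · intro hx
        have hd := hgE d (Or.inr ⟨μ, hx⟩)
        refine ⟨hd, ?_⟩
        rw [hg' _ hd, Equiv.symm_apply_apply]; exact hx
      · rintro ⟨h1, h2⟩
        rwa [hg' _ h1, Equiv.symm_apply_apply] at h2
  -- one inc step
  have hstep : ∀ V : Set D, E₀ ⊆ V → ∀ e ∈ E, e ∉ V → V ⊆ E → ∀ η η', IsBlow θ φ E₀ V η →
      IsBlow θ φ E₀ (insert e V) η' → inc η η' := by
    intro V hV e heE heV hVE η η' hη hη'
    have heE₀ : e ∉ E₀ := fun hh => heV (hV hh)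
    have gV : ∀ x ∈ V, η.gfun x = θ.gfun (φ x) := by
      intro x hx; ext μ
      rw [mem_gfun, hη.2.1, mem_gfun]
      exact ⟨fun hh => hh.2, fun hh => ⟨hx, hh⟩⟩
    have dE₀ : ∀ x ∈ E₀, η.dfun x = θ.dfun (φ x) := by
      rintro x hx; ext ⟨q, α⟩
      rw [mem_dfun, hη.1, mem_dfun]
      exact ⟨fun hh => hh.2.1, fun hh => ⟨hV hx, hh, fun _ => hx⟩⟩
    have dN : ∀ x ∉ V, x ∉ η.dataset := by
      rintro x hx (⟨qa, hq⟩ | ⟨μ, hμ⟩)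
      · rw [hη.1] at hq; exact hx hq.1
      · rw [hη.2.1] at hμ; exact hx hμ.1
    refine ⟨θ.dfun (φ e), θ.gfun (φ e), ?_, ?_, e, dN e heV, ?_, ?_, ?_, ?_, ?_⟩
    · by_cases hx : φ e ∈ θ.dataset
      · have hm : s (φ e) ∈ E₀ := ⟨_, hx, rfl⟩
        refine ⟨s (φ e), ?_, ?_⟩
        · rw [dE₀ _ hm, (hs _ hx).2]
        · rw [gV _ (hV hm), (hs _ hx).2]
      · refine ⟨e, ?_, ?_⟩
        · rw [dfun_empty (dN e heV), dfun_empty hx]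
        · rw [gfun_empty (dN e heV), gfun_empty hx]
    · by_cases hχ : θ.gfun (φ e) = ∅
      · obtain ⟨e₁, e₂, hne, h1, h2⟩ := exists_two_fresh η
        exact ⟨e₁, e₂, hne, by rw [hχ, gfun_empty h1], by rw [hχ, gfun_empty h2]⟩
      · have hx : φ e ∈ θ.dataset := by
          by_contra hc; exact hχ (gfun_empty hc)
        have hm : s (φ e) ∈ E₀ := ⟨_, hx, rfl⟩
        obtain ⟨y₁, y₂, hy, h1, h2⟩ := htwo e heE (s (φ e)) (hs _ hx).1
          (fun hh => heE₀ (hh ▸ hm)) (hs _ hx).2.symm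
        have d1 : y₁ ∈ θ.dataset := by
          by_contra hc; exact hχ (h1.symm.trans (gfun_empty hc))
        have d2 : y₂ ∈ θ.dataset := by
          by_contra hc; exact hχ (h2.symm.trans (gfun_empty hc))
        refine ⟨s y₁, s y₂, fun hh => hy (hinj d1 d2 hh), ?_, ?_⟩
        · rw [gV _ (hV ⟨_, d1, rfl⟩), (hs _ d1).2, h1]
        · rw [gV _ (hV ⟨_, d2, rfl⟩), (hs _ d2).2, h2]
    · rw [hη'.2.2.1, hη.2.2.1]
    · rw [hη'.2.2.2, hη.2.2.2]
    · intro d hd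
      constructor
      · ext ⟨q, α⟩
        rw [mem_dfun, mem_dfun, hη.1, hη'.1]
        simp only [Set.mem_ofPred_eq, Set.mem_insert_iff, hd, false_or]
      · ext μ
        rw [mem_gfun, mem_gfun, hη.2.1, hη'.2.1]
        simp only [Set.mem_ofPred_eq, Set.mem_insert_iff, hd, false_or]
    · ext ⟨q, α⟩
      rw [mem_dfun, hη'.1]
      simp only [Set.mem_ofPred_eq, Set.mem_insert_iff, true_or, true_and, heE₀, mem_dfun]
    · ext μ
      rw [mem_gfun, hη'.2.1]
      simp only [Set.mem_ofPred_eq, Set.mem_insert_iff, true_or, true_and, mem_gfun]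
  -- iterate
  have hiter : ∀ W : Finset D, (W : Set D) ⊆ E \ E₀ →
      ∃ η, IsBlow θ φ E₀ (E₀ ∪ W) η ∧ relPow inc W.card θ₀ η := by
    intro W
    induction W using Finset.induction_on with
    | empty => 
      intro _
      exact ⟨θ₀, by simpa using hθ₀, rfl⟩
    | insert e W he ih =>
      intro hW
      rw [Finset.coe_insert] at hW
      have heE := hW (Set.mem_insert _ _)
      have hWE : (W : Set D) ⊆ E \ E₀ := fun x hx => hW (Set.mem_insert_of_mem _ hx)
      obtain ⟨η, hη, hp⟩ := ih hWE
      have hVE : E₀ ∪ (W : Set D) ⊆ E := Set.union_subset hE₀E fun x hx => (hWE hx).1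
      obtain ⟨η', hη'⟩ := hex (insert e (E₀ ∪ (W : Set D)))
        (fun x hx => Or.inr (Or.inl hx)) (Set.insert_subset heE.1 hVE)
      refine ⟨η', ?_, ?_⟩
      · rw [Finset.coe_insert, Set.union_insert]; exact hη'
      · rw [Finset.card_insert_of_notMem he]
        refine relPow_snoc hp (hstep _ Set.subset_union_left e heE.1 ?_ hVE _ _ hη hη')
        rintro (hh | hh)
        · exact heE.2 hh
        · exact he hh
  have hfin : (E \ E₀).Finite := hE.subset Set.sdiff_subset
  obtain ⟨η, hη, hp⟩ := hiter hfin.toFinset (by simp)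
  refine ⟨θ₀, η, E₀, _, hsim, hp, ?_, ?_⟩
  · rw [← Set.ncard_eq_toFinset_card _ hfin]
    exact Set.ncard_le_ncard Set.sdiff_subset hE
  · simpa [Set.union_sdiff_cancel hE₀E] using hη

/-- `η` sits below `θ` via `ρ`, without the counting condition. -/
structure Sub (ρ : D → D) (η θ : EConf A B Q S D h) : Prop where
  r : η.r = θ.r
  m : η.m = θ.m
  Δr : ∀ x ∈ η.Δ, x.2.2 ∈ Set.range ρ
  Γr : ∀ x ∈ η.Γ, x.2 ∈ Set.range ρ
  Δ : ∀ q α e, (q, α, ρ e) ∈ η.Δ → (q, α, e) ∈ θ.Δ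
  Γ : ∀ μ e, (μ, ρ e) ∈ η.Γ ↔ (μ, e) ∈ θ.Γ

theorem prep [Infinite D] {K : Type} {κ : D → K} {E : Set D} {ρ : D → D} (hR : Retr κ E ρ)
    {f : D → D} {θ θ₁ : EConf A B Q S D h} (hf : pleF f θ θ₁)
    (hκ : ∀ e e', κ e = κ e' → f e = f e') :
    ∃ (θ₀ η : EConf A B Q S D h) (k : ℕ), simEquiv θ₀ θ ∧ relPow inc k θ₀ η ∧
      k ≤ E.ncard ∧ Sub ρ η θ₁ := by
  have hfρ : ∀ e, f (ρ e) = f e := fun e => hκ _ _ (hR.inv e)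
  obtain ⟨θ₀, η, E₀, k, h1, h2, h3, h4⟩ := blow θ f E hR.fin
    (by
      intro x hx
      obtain ⟨e, rfl⟩ := hf.2.1 hx
      exact ⟨ρ e, hR.mem e, hfρ e⟩)
    (by
      intro e _ e' _ hne hff
      have a1 := (hf.2.2 e).2
      have a2 := (hf.2.2 e').2
      rw [← hff] at a2
      exact pleF_two hf hne a1.symm a2.symm)
  have hp := hf.1
  simp only [EConf.profile, Prod.mk.injEq] at hp
  refine ⟨θ₀, η, k, h1, h2, h3, h4.2.2.1.trans hp.2.2.1, h4.2.2.2.trans hp.2.2.2, ?_, ?_, ?_, ?_⟩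
  · intro x hx
    rw [h4.1] at hx
    exact ⟨_, hR.fix _ hx.1⟩
  · intro x hx
    rw [h4.2.1] at hx
    exact ⟨_, hR.fix _ hx.1⟩
  · intro q α e hx
    rw [h4.1] at hx
    have := hx.2.1
    dsimp only at this
    rw [hfρ] at this
    exact (hf.2.2 e).1 ((mem_dfun _ _ _ _).2 this)
  · intro μ e
    rw [h4.2.1, ← mem_gfun θ₁, ← (hf.2.2 e).2, mem_gfun, ← hfρ]
    exact ⟨fun hh => hh.2, fun hh => ⟨hR.mem e, hh⟩⟩

theorem normalize [Infinite D] {f : D → D} {θ θ₁ : EConf A B Q S D h} (hf : pleF f θ θ₁) :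
    ∃ f', pleF f' θ θ₁ ∧ (∀ e, f' e ∈ Set.range f') ∧
      ∃ w, Set.range f' ⊆ insert w θ.dataset := by
  classical
  obtain ⟨w, hw⟩ := (dataset_finite θ).exists_notMem
  refine ⟨fun e => if f e ∈ θ.dataset then f e else w, ⟨hf.1, ?_, ?_⟩, fun e => ⟨e, rfl⟩, w, ?_⟩
  · intro x hx
    obtain ⟨e, rfl⟩ := hf.2.1 hx
    exact ⟨e, by simp only [if_pos hx]⟩
  · intro d
    by_cases hd : f d ∈ θ.dataset
    · simp only [if_pos hd]; exact hf.2.2 d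
    · simp only [if_neg hd]
      rw [dfun_empty hw, gfun_empty hw, ← (hf.2.2 d).2, gfun_empty hd]
      exact ⟨Set.empty_subset _, rfl⟩
  · rintro _ ⟨e, rfl⟩
    dsimp only
    split_ifs with hh
    · exact Or.inr hh
    · exact Or.inl rfl

theorem DerivesN.mono [Semigroup S] {δ : List (NTrans Q S)} {n : ℕ}
    {Θ : Set (EConf A B Q S D h)} {θ : EConf A B Q S D h} (hd : DerivesN δ n Θ θ) :
    ∀ {Θ' : Set (EConf A B Q S D h)}, Θ ⊆ Θ' → DerivesN δ n Θ' θ := by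
  have hs : ∀ {Θ Θ' : Set (EConf A B Q S D h)} {θ}, Θ ⊆ Θ' → stepFrom δ Θ θ →
      stepFrom δ Θ' θ := by
    rintro Θ Θ' θ hss (⟨a, ha, hh⟩ | ⟨a, ha, b, hb, hh⟩)
    · exact Or.inl ⟨a, hss ha, hh⟩
    · exact Or.inr ⟨a, hss ha, b, hss hb, hh⟩
  induction hd with
  | base h1 => intro Θ' hss; exact .base (hs hss h1)
  | step h1 _ ih =>
    intro Θ' hss
    exact .step (hs hss h1) (ih (Set.union_subset_union_left _ hss))

theorem derives_cut [Semigroup S] {δ : List (NTrans Q S)} {n : ℕ} {θ : EConf A B Q S D h} :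
    ∀ {k : ℕ} {Θ : Set (EConf A B Q S D h)} {a b : EConf A B Q S D h}, a ∈ Θ →
      relPow inc k a b → DerivesN δ n (Θ ∪ {b}) θ → DerivesN δ (n + k) Θ θ
  | 0, Θ, a, b, ha, hp, hd => by
    cases hp
    refine hd.mono (Set.union_subset subset_rfl ?_)
    rintro _ rfl; exact ha
  | k + 1, Θ, a, b, ha, ⟨x, hx, hp⟩, hd => by
    refine .step (Or.inl ⟨a, ha, Or.inr (Or.inl hx)⟩) ?_
    refine derives_cut (a := x) (b := b) (Or.inr rfl) hp (hd.mono ?_)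
    exact Set.union_subset_union_left _ Set.subset_union_left

theorem stutter [Infinite D] (θ : EConf A B Q S D h) : inc θ θ := by
  obtain ⟨e₁, e₂, hne, h1, h2⟩ := exists_two_fresh θ
  refine ⟨∅, ∅, ⟨e₁, dfun_empty h1, gfun_empty h1⟩, ⟨e₁, e₂, hne, gfun_empty h1, gfun_empty h2⟩,
    e₁, h1, rfl, rfl, fun _ _ => ⟨rfl, rfl⟩, ?_, gfun_empty h1⟩
  rw [dfun_empty h1]; ext; simp

theorem prep2 [Infinite D] {f : D → D} {θ θ₁ : EConf A B Q S D h} (hf : pleF f θ θ₁) (a b : D) :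
    ∃ (θ₀ η : EConf A B Q S D h) (k : ℕ) (κ : D → D × Prop × Prop) (E : Set D) (ρ : D → D),
      simEquiv θ₀ θ ∧ relPow inc k θ₀ η ∧ k ≤ 8 * (θ.dataset.ncard + 1) ∧ Sub ρ η θ₁ ∧
      Retr κ E ρ ∧ (∀ e e', κ e = κ e' →
        θ₁.gfun e = θ₁.gfun e' ∧ (e = a ↔ e' = a) ∧ (e = b ↔ e' = b)) ∧
      (∀ x, ρ x = a ↔ x = a) ∧ (∀ x, ρ x = b ↔ x = b) := by
  obtain ⟨f, hf, -, w, hw⟩ := normalize hf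
  have hfin : (insert w θ.dataset).Finite := (dataset_finite θ).insert w
  have hsub : Set.range (fun e => (f e, e = a, e = b)) ⊆
      insert w θ.dataset ×ˢ (Set.univ : Set (Prop × Prop)) := by
    rintro _ ⟨e, rfl⟩
    exact ⟨hw ⟨e, rfl⟩, trivial⟩
  have hpf : (insert w θ.dataset ×ˢ (Set.univ : Set (Prop × Prop))).Finite :=
    hfin.prod Set.finite_univ
  have hcard : (Set.range (fun e => (f e, e = a, e = b))).ncard ≤ 4 * (θ.dataset.ncard + 1) := by
    have h1 := Set.ncard_le_ncard hsub hpf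
    have h2 := Set.ncard_insert_le w θ.dataset
    rw [Set.ncard_prod, Set.ncard_univ, Nat.card_eq_fintype_card, Fintype.card_prod,
      Fintype.card_prop] at h1
    omega
  obtain ⟨E, ρ, hR⟩ := exists_retr (fun e => (f e, e = a, e = b)) (hpf.subset hsub)
  obtain ⟨θ₀, η, k, h1, h2, h3, h4⟩ := prep hR hf (fun e e' hh => (Prod.mk.inj hh).1)
  have hk : ∀ e e', (f e, e = a, e = b) = (f e', e' = a, e' = b) →
      f e = f e' ∧ (e = a ↔ e' = a) ∧ (e = b ↔ e' = b) := by
    intro e e' hh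
    simp only [Prod.mk.injEq] at hh
    exact ⟨hh.1, iff_of_eq hh.2.1, iff_of_eq hh.2.2⟩
  refine ⟨θ₀, η, k, _, E, ρ, h1, h2, ?_, h4, hR, ?_, ?_, ?_⟩
  · have := hR.card
    omega
  · intro e e' hh
    obtain ⟨q1, q2⟩ := hk e e' hh
    refine ⟨?_, q2⟩
    rw [← (hf.2.2 e).2, ← (hf.2.2 e').2, q1]
  · exact fun x => (hk _ _ (hR.inv x)).2.1
  · exact fun x => (hk _ _ (hR.inv x)).2.2

theorem eps_finish [Infinite D] {K : Type} {κ : D → K} {E : Set D} {ρ : D → D}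
    (hR : Retr κ E ρ) {η θ₁ θ' : EConf A B Q S D h} (hS : Sub ρ η θ₁)
    (hκ : ∀ e e', κ e = κ e' → θ₁.gfun e = θ₁.gfun e')
    (hr : θ'.r = θ₁.r) (hm : θ'.m = θ₁.m) (hΓ : θ'.Γ = θ₁.Γ) (q : Q) (α : TA Q S) (d : D)
    (hd : ρ d = d) (N' N₂ : Set (Q × TA Q S × D))
    (hΔ : θ'.Δ = θ₁.Δ \ {(q, α, d)} ∪ N') (hN₂ : ∀ x ∈ N₂, x.2.2 ∈ Set.range ρ)
    (hN : ∀ p β e, (p, β, ρ e) ∈ N₂ → (p, β, e) ∈ N') :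
    ∃ θ₂ : EConf A B Q S D h, ple θ₂ θ' ∧ θ₂.r = η.r ∧ θ₂.m = η.m ∧ θ₂.Γ = η.Γ ∧
      (((q, α, d) ∈ η.Δ ∧ θ₂.Δ = η.Δ \ {(q, α, d)} ∪ N₂) ∨ inc η θ₂) := by
  have hg : ∀ e e', κ e = κ e' → θ'.gfun e = θ'.gfun e' := by
    intro e e' hh
    have := hκ e e' hh
    unfold EConf.gfun at this ⊢
    rw [hΓ]; exact this
  have hold : ∀ p β e, (p, β, ρ e) ∈ η.Δ → (p, β, ρ e) ≠ (q, α, d) → (p, β, e) ∈ θ'.Δ := by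
    intro p β e hm hne
    rw [hΔ]
    refine Or.inl ⟨hS.Δ _ _ _ hm, ?_⟩
    intro hh
    simp only [Set.mem_singleton_iff, Prod.mk.injEq] at hh
    obtain ⟨rfl, rfl, rfl⟩ := hh
    exact hne (by rw [hd])
  have hΓ₂ : ∀ μ e, (μ, ρ e) ∈ η.Γ ↔ (μ, e) ∈ θ'.Γ := by
    intro μ e; rw [hΓ]; exact hS.Γ μ e
  by_cases ht : (q, α, d) ∈ η.Δ
  · obtain ⟨θ₂, e1, e2, e3, e4, e5⟩ := build hR θ' hg (η.Δ \ {(q, α, d)} ∪ N₂) η.Γ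
      (by
        rintro x (hx | hx)
        · exact hS.Δr x hx.1
        · exact hN₂ x hx) hS.Γr
      (by
        rintro p β e (hx | hx)
        · exact hold p β e hx.1 hx.2
        · rw [hΔ]; exact Or.inr (hN _ _ _ hx)) hΓ₂
    exact ⟨θ₂, ⟨ρ, e5⟩, by rw [e3, hr, hS.r], by rw [e4, hm, hS.m], e2, Or.inl ⟨ht, e1⟩⟩
  · obtain ⟨θ₂, e1, e2, e3, e4, e5⟩ := build hR θ' hg η.Δ η.Γ hS.Δr hS.Γr
      (by
        intro p β e hx
        exact hold p β e hx (fun hh => ht (hh ▸ hx))) hΓ₂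
    have : θ₂ = η := by
      have e3' : θ₂.r = η.r := by rw [e3, hr, hS.r]
      have e4' : θ₂.m = η.m := by rw [e4, hm, hS.m]
      cases θ₂; cases η
      simp only at e1 e2 e3' e4'
      subst e1 e2 e3' e4'
      rfl
    subst this
    exact ⟨θ₂, ⟨ρ, e5⟩, rfl, rfl, rfl, Or.inr (stutter θ₂)⟩

theorem test_iff {ρ : D → D} {η θ₁ : EConf A B Q S D h} (hS : Sub ρ η θ₁) {d : D}
    (hd : ∀ x, ρ x = d ↔ x = d) (q : Q) (neg : Bool) (t : NTest Q S) :
    taTestHolds η q d neg t ↔ taTestHolds θ₁ q d neg t := by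
  have hdd : ρ d = d := (hd d).2 rfl
  have : ntestHolds η q d t ↔ ntestHolds θ₁ q d t := by
    cases t with
    | state p => exact Iff.rfl
    | deq μ =>
      have := hS.Γ μ d
      rw [hdd] at this
      exact this
    | dneq μ =>
      constructor
      · rintro ⟨e, hne, he⟩
        obtain ⟨x, rfl⟩ := hS.Γr _ he
        exact ⟨x, fun hh => hne ((hd x).2 hh), (hS.Γ _ _).1 he⟩
      · rintro ⟨e, hne, he⟩
        exact ⟨ρ e, fun hh => hne ((hd e).1 hh), (hS.Γ _ _).2 he⟩
    | root =>
      change η.r = true ↔ θ₁.r = true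
      rw [hS.r]
  unfold taTestHolds
  rw [this]

theorem eps_case [Infinite D] [Semigroup S] {δ : List (NTrans Q S)} {f : D → D}
    {θ θ₁ θ' : EConf A B Q S D h} (hf : pleF f θ θ₁) (hst : epsStep δ θ₁ θ') :
    ∃ (θ₀ η θ₂ : EConf A B Q S D h) (k : ℕ), simEquiv θ₀ θ ∧ relPow inc k θ₀ η ∧
      k ≤ 8 * (θ.dataset.ncard + 1) ∧ ple θ₂ θ' ∧ anyStep δ η θ₂ := by
  obtain ⟨m1, m2, hr, hΓ, q, d, hst⟩ := hst
  have hm : θ'.m = θ₁.m := m2.trans m1.symm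
  rcases hst with ⟨tr, htr, ht, hΔ⟩ | ⟨p, ht, hΔ⟩ | ⟨p, d', ht, hΔ⟩ | ⟨p, d', ht, hd', hΔ⟩ |
    ⟨p, ht, hΔ⟩ | ⟨ht, hΔ⟩ | ⟨neg, t, ht, hh, hΔ⟩
  · obtain ⟨θ₀, η, k, κ, E, ρ, s1, s2, s3, hS, hR, hκ, ia, ib⟩ := prep2 hf d d
    have hdd : ρ d = d := (ia d).2 rfl
    obtain ⟨θ₂, hp, er, em, eΓ, hc⟩ := eps_finish hR hS (fun e e' he => (hκ e e' he).1) hr hm hΓ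
      q _ d hdd _ {x | x.1 = q ∧ x.2.2 = d ∧ x.2.1 ∈ taSet tr} hΔ
      (by rintro x ⟨-, hx, -⟩; exact ⟨d, hdd.trans hx.symm⟩)
      (by rintro p β e ⟨h1, h2, h3⟩; exact ⟨h1, (ia e).1 h2, h3⟩)
    refine ⟨θ₀, η, θ₂, k, s1, s2, s3, hp, ?_⟩
    rcases hc with ⟨c1, c2⟩ | hc
    · exact Or.inl ⟨hS.m.trans m1, em.trans (hS.m.trans m1), er, eΓ, q, d,
        Or.inl ⟨tr, htr, c1, c2⟩⟩
    · exact Or.inr (Or.inl hc)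
  · obtain ⟨θ₀, η, k, κ, E, ρ, s1, s2, s3, hS, hR, hκ, ia, ib⟩ := prep2 hf d d
    have hdd : ρ d = d := (ia d).2 rfl
    obtain ⟨θ₂, hp, er, em, eΓ, hc⟩ := eps_finish hR hS (fun e e' he => (hκ e e' he).1) hr hm hΓ
      q _ d hdd _ {x | x.1 = p ∧ x.2.1 = TA.top ∧ ∃ μ : S, (μ, x.2.2) ∈ η.Γ} hΔ
      (by rintro x ⟨-, -, μ, hμ⟩; exact hS.Γr _ hμ)
      (by rintro p β e ⟨h1, h2, μ, hμ⟩; exact ⟨h1, h2, μ, (hS.Γ _ _).1 hμ⟩)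
    refine ⟨θ₀, η, θ₂, k, s1, s2, s3, hp, ?_⟩
    rcases hc with ⟨c1, c2⟩ | hc
    · exact Or.inl ⟨hS.m.trans m1, em.trans (hS.m.trans m1), er, eΓ, q, d,
        Or.inr (Or.inl ⟨p, c1, c2⟩)⟩
    · exact Or.inr (Or.inl hc)
  · obtain ⟨θ₀, η, k, κ, E, ρ, s1, s2, s3, hS, hR, hκ, ia, ib⟩ := prep2 hf d d'
    have hdd : ρ d = d := (ia d).2 rfl
    obtain ⟨θ₂, hp, er, em, eΓ, hc⟩ := eps_finish hR hS (fun e e' he => (hκ e e' he).1) hr hm hΓ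
      q _ d hdd _ {(p, TA.topg, d')} hΔ
      (by rintro x rfl; exact ⟨d', (ib d').2 rfl⟩)
      (by
        intro p' β e hx
        simp only [Set.mem_singleton_iff, Prod.mk.injEq, ib] at hx ⊢
        exact hx)
    refine ⟨θ₀, η, θ₂, k, s1, s2, s3, hp, ?_⟩
    rcases hc with ⟨c1, c2⟩ | hc
    · exact Or.inl ⟨hS.m.trans m1, em.trans (hS.m.trans m1), er, eΓ, q, d,
        Or.inr (Or.inr (Or.inl ⟨p, d', c1, c2⟩))⟩
    · exact Or.inr (Or.inl hc)
  · obtain ⟨θ₀, η, k, κ, E, ρ, s1, s2, s3, hS, hR, hκ, ia, ib⟩ := prep2 hf d d'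
    have hdd : ρ d = d := (ia d).2 rfl
    obtain ⟨θ₂, hp, er, em, eΓ, hc⟩ := eps_finish hR hS (fun e e' he => (hκ e e' he).1) hr hm hΓ
      q _ d hdd _ {(p, TA.top, d')} hΔ
      (by rintro x rfl; exact ⟨d', (ib d').2 rfl⟩)
      (by
        intro p' β e hx
        simp only [Set.mem_singleton_iff, Prod.mk.injEq, ib] at hx ⊢
        exact hx)
    refine ⟨θ₀, η, θ₂, k, s1, s2, s3, hp, ?_⟩
    rcases hc with ⟨c1, c2⟩ | hc
    · refine Or.inl ⟨hS.m.trans m1, em.trans (hS.m.trans m1), er, eΓ, q, d,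
        Or.inr (Or.inr (Or.inr (Or.inl ⟨p, d', c1, ?_, c2⟩)))⟩
      obtain ⟨μ, hμ, hcc⟩ := hd'
      refine ⟨μ, ?_, hcc⟩
      have := (hS.Γ μ d').2 hμ
      rwa [(ib d').2 rfl] at this
    · exact Or.inr (Or.inl hc)
  · obtain ⟨θ₀, η, k, κ, E, ρ, s1, s2, s3, hS, hR, hκ, ia, ib⟩ := prep2 hf d d
    have hdd : ρ d = d := (ia d).2 rfl
    obtain ⟨θ₂, hp, er, em, eΓ, hc⟩ := eps_finish hR hS (fun e e' he => (hκ e e' he).1) hr hm hΓ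
      q _ d hdd _ {(p, TA.top, d)} hΔ
      (by rintro x rfl; exact ⟨d, hdd⟩)
      (by
        intro p' β e hx
        simp only [Set.mem_singleton_iff, Prod.mk.injEq, ia] at hx ⊢
        exact hx)
    refine ⟨θ₀, η, θ₂, k, s1, s2, s3, hp, ?_⟩
    rcases hc with ⟨c1, c2⟩ | hc
    · exact Or.inl ⟨hS.m.trans m1, em.trans (hS.m.trans m1), er, eΓ, q, d,
        Or.inr (Or.inr (Or.inr (Or.inr (Or.inl ⟨p, c1, c2⟩))))⟩
    · exact Or.inr (Or.inl hc)
  · obtain ⟨θ₀, η, k, κ, E, ρ, s1, s2, s3, hS, hR, hκ, ia, ib⟩ := prep2 hf d d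
    have hdd : ρ d = d := (ia d).2 rfl
    rw [← Set.union_empty (θ₁.Δ \ _)] at hΔ
    obtain ⟨θ₂, hp, er, em, eΓ, hc⟩ := eps_finish hR hS (fun e e' he => (hκ e e' he).1) hr hm hΓ
      q _ d hdd _ ∅ hΔ (fun x hx => hx.elim) (fun p β e hx => hx.elim)
    refine ⟨θ₀, η, θ₂, k, s1, s2, s3, hp, ?_⟩
    rcases hc with ⟨c1, c2⟩ | hc
    · rw [Set.union_empty] at c2
      exact Or.inl ⟨hS.m.trans m1, em.trans (hS.m.trans m1), er, eΓ, q, d,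
        Or.inr (Or.inr (Or.inr (Or.inr (Or.inr (Or.inl ⟨c1, c2⟩)))))⟩
    · exact Or.inr (Or.inl hc)
  · obtain ⟨θ₀, η, k, κ, E, ρ, s1, s2, s3, hS, hR, hκ, ia, ib⟩ := prep2 hf d d
    have hdd : ρ d = d := (ia d).2 rfl
    rw [← Set.union_empty (θ₁.Δ \ _)] at hΔ
    obtain ⟨θ₂, hp, er, em, eΓ, hc⟩ := eps_finish hR hS (fun e e' he => (hκ e e' he).1) hr hm hΓ
      q _ d hdd _ ∅ hΔ (fun x hx => hx.elim) (fun p β e hx => hx.elim)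
    refine ⟨θ₀, η, θ₂, k, s1, s2, s3, hp, ?_⟩
    rcases hc with ⟨c1, c2⟩ | hc
    · rw [Set.union_empty] at c2
      exact Or.inl ⟨hS.m.trans m1, em.trans (hS.m.trans m1), er, eΓ, q, d,
        Or.inr (Or.inr (Or.inr (Or.inr (Or.inr (Or.inr
          ⟨neg, t, c1, (test_iff hS ia q neg t).2 hh, c2⟩)))))⟩
    · exact Or.inr (Or.inl hc)

theorem inc_case [Infinite D] {f : D → D}
    {θ θ₁ θ' : EConf A B Q S D h} (hf : pleF f θ θ₁) (hst : inc θ₁ θ') :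
    ∃ (θ₀ η θ₂ : EConf A B Q S D h) (k : ℕ), simEquiv θ₀ θ ∧ relPow inc k θ₀ η ∧
      k ≤ 8 * (θ.dataset.ncard + 1) ∧ ple θ₂ θ' ∧ inc η θ₂ := by
  obtain ⟨Sq, χ, ⟨d, rfl, hdχ⟩, ⟨u, v, huv, hu, hv⟩, e, he, hr, hm, hoth, hΔe, hΓe⟩ := hst
  obtain ⟨θ₀, η, k, κ, E, ρ, s1, s2, s3, hS, hR, hκ, ia, ib⟩ := prep2 hf d e
  have hdd : ρ d = d := (ia d).2 rfl
  have hee : ρ e = e := (ib e).2 rfl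
  have hg : ∀ x, η.gfun (ρ x) = θ₁.gfun x := fun x => Set.ext fun μ => hS.Γ μ x
  have hgd : η.gfun d = χ := by rw [← hdχ, ← hg d, hdd]
  have heη : e ∉ η.dataset := by
    rintro (⟨⟨q, α⟩, hq⟩ | ⟨μ, hμ⟩)
    · rw [← hee] at hq
      exact he (Or.inl ⟨(q, α), hS.Δ _ _ _ hq⟩)
    · rw [← hee] at hμ
      exact he (Or.inr ⟨μ, (hS.Γ _ _).1 hμ⟩)
  have hΔη : ∀ q α, (q, α, e) ∉ η.Δ := fun q α hq => heη (Or.inl ⟨(q, α), hq⟩)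
  have hΓη : ∀ μ, (μ, e) ∉ η.Γ := fun μ hq => heη (Or.inr ⟨μ, hq⟩)
  obtain ⟨θ₂, e1, e2, e3, e4, e5⟩ := build hR θ'
    (by
      intro x x' hh
      obtain ⟨k1, -, k2⟩ := hκ x x' hh
      by_cases hx : x = e
      · rw [hx, k2.1 hx]
      · rw [(hoth x hx).2, (hoth x' (fun hh => hx (k2.2 hh))).2, k1])
    (η.Δ ∪ {x | x.2.2 = e ∧ (x.1, x.2.1, d) ∈ η.Δ ∧ x.2.1 ≠ TA.topg})
    (η.Γ ∪ {y | y.2 = e ∧ (y.1, d) ∈ η.Γ})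
    (by
      rintro x (hx | hx)
      · exact hS.Δr _ hx
      · exact ⟨e, hee.trans hx.1.symm⟩)
    (by
      rintro x (hx | hx)
      · exact hS.Γr _ hx
      · exact ⟨e, hee.trans hx.1.symm⟩)
    (by
      rintro q α x (hx | ⟨h1, h2, h3⟩)
      · have hx' := hS.Δ _ _ _ hx
        have hxe : x ≠ e := by
          rintro rfl; exact he (Or.inl ⟨(q, α), hx'⟩)
        rw [← mem_dfun, (hoth x hxe).1]; exact hx'
      · have hxe := (ib x).1 h1
        subst hxe
        dsimp only at h2 h3
        rw [← hdd] at h2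
        rw [← mem_dfun, hΔe]
        exact ⟨hS.Δ _ _ _ h2, h3⟩)
    (by
      intro μ x
      by_cases hx : x = e
      · subst hx
        rw [← mem_gfun θ', hΓe, ← hgd, hee]
        constructor
        · rintro (hh | ⟨-, hh⟩)
          · exact absurd hh (hΓη μ)
          · exact hh
        · intro hh; exact Or.inr ⟨rfl, hh⟩
      · rw [← mem_gfun θ', (hoth x hx).2, mem_gfun, ← hS.Γ]
        constructor
        · rintro (hh | ⟨h1, -⟩)
          · exact hh
          · exact absurd ((ib x).1 h1) hx
        · intro hh; exact Or.inl hh)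
  refine ⟨θ₀, η, θ₂, k, s1, s2, s3, ⟨ρ, e5⟩, η.dfun d, χ, ⟨d, rfl, hgd⟩, ?_, e, heη,
    by rw [e3, hr, hS.r], by rw [e4, hm, hS.m], ?_, ?_, ?_⟩
  · by_cases hρ : ρ u = ρ v
    · have hk : κ u = κ v := by rw [← hR.inv u, hρ, hR.inv]
      obtain ⟨x, y, hxy, hx, hy, kx, ky⟩ := hR.two u v huv hk
      refine ⟨x, y, hxy, ?_, ?_⟩
      · rw [← hR.fix x hx, hg, (hκ _ _ kx).1, hu]
      · rw [← hR.fix y hy, hg, (hκ _ _ ky).1, hu]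
    · exact ⟨ρ u, ρ v, hρ, (hg u).trans hu, (hg v).trans hv⟩
  · intro x hx
    constructor
    · ext ⟨q, α⟩
      rw [mem_dfun, mem_dfun, e1]
      constructor
      · rintro (hh | ⟨h1, -⟩)
        · exact hh
        · exact absurd h1 hx
      · exact Or.inl
    · ext μ
      rw [mem_gfun, mem_gfun, e2]
      constructor
      · rintro (hh | ⟨h1, -⟩)
        · exact hh
        · exact absurd h1 hx
      · exact Or.inl
  · ext ⟨q, α⟩
    rw [mem_dfun, e1]
    constructor
    · rintro (hh | ⟨-, h1, h2⟩)
      · exact absurd hh (hΔη _ _)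
      · exact ⟨h1, h2⟩
    · rintro ⟨h1, h2⟩; exact Or.inr ⟨rfl, h1, h2⟩
  · ext μ
    rw [mem_gfun, e2, ← hgd]
    constructor
    · rintro (hh | ⟨-, h1⟩)
      · exact absurd hh (hΓη _)
      · exact h1
    · intro h1; exact Or.inr ⟨rfl, h1⟩

theorem grow_case [Infinite D] [Semigroup S] {f : D → D}
    {θ θ₁ θ' : EConf A B Q S D h} (hf : pleF f θ θ₁) (hst : growStep θ₁ θ') :
    ∃ (θ₀ η θ₂ : EConf A B Q S D h) (k : ℕ), simEquiv θ₀ θ ∧ relPow inc k θ₀ η ∧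
      k ≤ 8 * (θ.dataset.ncard + 1) ∧ ple θ₂ θ' ∧ growStep η θ₂ := by
  obtain ⟨r1, m1, hall, hΔ, c, d, hΓ⟩ := hst
  obtain ⟨θ₀, η, k, κ, E, ρ, s1, s2, s3, hS, hR, hκ, ia, ib⟩ := prep2 hf d d
  have hdd : ρ d = d := (ia d).2 rfl
  have hΓ' : ∀ ν x, (ν, x) ∈ θ'.Γ ↔ (∃ μ, (μ, x) ∈ θ₁.Γ ∧ ν = h c * μ) ∨ (ν = h c ∧ x = d) := by
    intro ν x
    rw [hΓ]
    constructor
    · rintro (⟨μ, e, hm, he⟩ | hh)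
      · obtain ⟨rfl, rfl⟩ := Prod.mk.inj he
        exact Or.inl ⟨μ, hm, rfl⟩
      · exact Or.inr (Prod.mk.inj hh)
    · rintro (⟨μ, hm, rfl⟩ | ⟨rfl, rfl⟩)
      · exact Or.inl ⟨μ, x, hm, rfl⟩
      · exact Or.inr rfl
  obtain ⟨θ₂, e1, e2, e3, e4, e5⟩ := build hR θ'
    (by
      intro e e' hh
      obtain ⟨k1, k2, -⟩ := hκ e e' hh
      ext ν
      rw [mem_gfun, mem_gfun, hΓ', hΓ', k2]
      simp only [← mem_gfun, k1])
    {x | x.2.1 = TA.bot ∧ ∃ α : TA Q S, (x.1, α, x.2.2) ∈ η.Δ}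
    ({y | ∃ μ : S, ∃ e : D, (μ, e) ∈ η.Γ ∧ y = (h c * μ, e)} ∪ {(h c, d)})
    (by rintro x ⟨-, α, hx⟩; exact hS.Δr (x.1, α, x.2.2) hx)
    (by
      rintro x (⟨μ, e, hm, rfl⟩ | rfl)
      · exact hS.Γr (μ, e) hm
      · exact ⟨d, hdd⟩)
    (by
      rintro q α e ⟨h1, β, h2⟩
      rw [hΔ]
      exact ⟨h1, β, hS.Δ _ _ _ h2⟩)
    (by
      intro ν x
      rw [hΓ']
      constructor
      · rintro (⟨μ, e, hm, he⟩ | hh)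
        · obtain ⟨rfl, rfl⟩ := Prod.mk.inj he
          exact Or.inl ⟨μ, (hS.Γ _ _).1 hm, rfl⟩
        · obtain ⟨h1, h2⟩ := Prod.mk.inj hh
          exact Or.inr ⟨h1, (ia x).1 h2⟩
      · rintro (⟨μ, hm, rfl⟩ | ⟨rfl, rfl⟩)
        · exact Or.inl ⟨μ, ρ x, (hS.Γ _ _).2 hm, rfl⟩
        · exact Or.inr (by rw [hdd]; rfl))
  refine ⟨θ₀, η, θ₂, k, s1, s2, s3, ⟨ρ, e5⟩, hS.r.trans r1, hS.m.trans m1, ?_, e1, c, d, e2⟩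
  rintro ⟨q, α, x⟩ hx
  obtain ⟨y, rfl⟩ := hS.Δr _ hx
  exact hall (q, α, y) (hS.Δ _ _ _ hx)

theorem merge_case [Infinite D] {f₁ f₂ : D → D}
    {θ₁ θ₂ θ₁' θ₂' θ' : EConf A B Q S D h} (hf₁ : pleF f₁ θ₁ θ₁') (hf₂ : pleF f₂ θ₂ θ₂')
    (hst : mergeStep θ₁' θ₂' θ') :
    ∃ (a₁ a₂ η₁ η₂ ζ : EConf A B Q S D h) (k₁ k₂ : ℕ), simEquiv a₁ θ₁ ∧ simEquiv a₂ θ₂ ∧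
      relPow inc k₁ a₁ η₁ ∧ relPow inc k₂ a₂ η₂ ∧
      k₁ ≤ 2 * ((θ₁.dataset.ncard + 1) * (θ₂.dataset.ncard + 1)) ∧
      k₂ ≤ 2 * ((θ₁.dataset.ncard + 1) * (θ₂.dataset.ncard + 1)) ∧
      ple ζ θ' ∧ mergeStep η₁ η₂ ζ := by
  obtain ⟨ri, ri', m1, m2, hr, hr', hΔ, hΓ⟩ := hst
  obtain ⟨f₁, hf₁, -, w₁, hw₁⟩ := normalize hf₁
  obtain ⟨f₂, hf₂, -, w₂, hw₂⟩ := normalize hf₂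
  have hsub : Set.range (fun e => (f₁ e, f₂ e)) ⊆
      insert w₁ θ₁.dataset ×ˢ insert w₂ θ₂.dataset := by
    rintro _ ⟨e, rfl⟩
    exact ⟨hw₁ ⟨e, rfl⟩, hw₂ ⟨e, rfl⟩⟩
  have hpf : (insert w₁ θ₁.dataset ×ˢ insert w₂ θ₂.dataset).Finite :=
    ((dataset_finite θ₁).insert w₁).prod ((dataset_finite θ₂).insert w₂)
  have hcard : (Set.range (fun e => (f₁ e, f₂ e))).ncard ≤
      (θ₁.dataset.ncard + 1) * (θ₂.dataset.ncard + 1) := by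
    have h1 := Set.ncard_le_ncard hsub hpf
    rw [Set.ncard_prod] at h1
    exact h1.trans (Nat.mul_le_mul (Set.ncard_insert_le _ _) (Set.ncard_insert_le _ _))
  obtain ⟨E, ρ, hR⟩ := exists_retr (fun e => (f₁ e, f₂ e)) (hpf.subset hsub)
  obtain ⟨a₁, η₁, k₁, s1, p1, b1, S1⟩ := prep hR hf₁ (fun e e' hh => (Prod.mk.inj hh).1)
  obtain ⟨a₂, η₂, k₂, s2, p2, b2, S2⟩ := prep hR hf₂ (fun e e' hh => (Prod.mk.inj hh).2)
  have hc := hR.card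
  obtain ⟨ζ, e1, e2, e3, e4, e5⟩ := build hR θ'
    (by
      intro e e' hh
      obtain ⟨k1, k2⟩ := Prod.mk.inj hh
      have g1 : θ₁'.gfun e = θ₁'.gfun e' := by rw [← (hf₁.2.2 e).2, ← (hf₁.2.2 e').2, k1]
      have g2 : θ₂'.gfun e = θ₂'.gfun e' := by rw [← (hf₂.2.2 e).2, ← (hf₂.2.2 e').2, k2]
      ext ν
      rw [mem_gfun, mem_gfun, hΓ, Set.mem_union, Set.mem_union, ← mem_gfun, ← mem_gfun,
        ← mem_gfun, ← mem_gfun, g1, g2])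
    (η₁.Δ ∪ η₂.Δ) (η₁.Γ ∪ η₂.Γ)
    (by
      rintro x (hx | hx)
      · exact S1.Δr _ hx
      · exact S2.Δr _ hx)
    (by
      rintro x (hx | hx)
      · exact S1.Γr _ hx
      · exact S2.Γr _ hx)
    (by
      rintro q α e hx
      rw [hΔ]
      exact hx.imp (S1.Δ _ _ _) (S2.Δ _ _ _))
    (by
      intro μ e
      rw [hΓ, Set.mem_union, Set.mem_union, S1.Γ, S2.Γ])
  -- the root of `η₁`, `η₂` and `ζ` is the image of the common root
  have hroot : ∀ (η τ : EConf A B Q S D h), (∀ x ∈ η.Γ, x.2 ∈ Set.range ρ) →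
      (∀ μ e, (μ, ρ e) ∈ η.Γ ↔ (μ, e) ∈ τ.Γ) →
      η.rootInfo = (fun x => (x.1, ρ x.2)) '' τ.rootInfo := by
    intro η τ h1 h2
    ext ⟨μ, x⟩
    constructor
    · rintro ⟨hx, hc⟩
      obtain ⟨y, rfl⟩ := h1 _ hx
      exact ⟨(μ, y), ⟨(h2 _ _).1 hx, hc⟩, rfl⟩
    · rintro ⟨⟨ν, y⟩, ⟨hy, hc⟩, hh⟩
      obtain ⟨rfl, rfl⟩ := Prod.mk.inj hh
      exact ⟨(h2 _ _).2 hy, hc⟩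
  have R1 := hroot η₁ θ₁' S1.Γr S1.Γ
  have R2 := hroot η₂ θ₂' S2.Γr S2.Γ
  have R3 := hroot ζ θ'
    (by
      intro x hx
      rw [e2] at hx
      rcases hx with hx | hx
      · exact S1.Γr _ hx
      · exact S2.Γr _ hx)
    (by
      intro μ e
      rw [e2, hΓ, Set.mem_union, Set.mem_union, S1.Γ, S2.Γ])
  refine ⟨a₁, a₂, η₁, η₂, ζ, k₁, k₂, s1, s2, p1, p2, by omega, by omega, ⟨ρ, e5⟩, ?_, ?_,
    S1.m.trans m1, S2.m.trans m2, ?_, ?_, e1, e2⟩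
  · rw [R1, R2, ri]
  · rw [R1, R3, ri']
  · rw [e3, hr, S1.r]
  · rw [S1.r, S2.r, hr']

end Proof

/-- **Compatibility of the transition system with `⪯` (Proposition 3.6)**: if
`Θ ≤min Θ'` for finite sets of extended configurations and `Θ' ⟹ θ'`, then
some `θ ⪯ θ'` satisfies `Θ^∼ ⟹ⁿ θ` for some `n` bounded by a (computable)
function of `Θ`. -/
theorem compatibility (A B Q S D : Type) [Fintype A] [Fintype B]
    [Fintype Q] [Fintype S] [Semigroup S] [Infinite D] (h : A × B → S)
    (hNF1 : NF1 h) (δ : List (NTrans Q S)) :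
    ∃ F : Set (EConf A B Q S D h) → ℕ,
      ∀ Θ Θ' : Set (EConf A B Q S D h), Θ.Finite → Θ'.Finite → leMin Θ Θ' →
        ∀ θ' : EConf A B Q S D h, stepFrom δ Θ' θ' →
          ∃ (θ : EConf A B Q S D h) (n : ℕ),
            ple θ θ' ∧ n ≤ F Θ ∧ DerivesN δ n (simClose Θ) θ := by
  classical
  refine ⟨fun Θ => 8 * ((⋃ θ ∈ Θ, θ.dataset).ncard + 1) +
    4 * (((⋃ θ ∈ Θ, θ.dataset).ncard + 1) * ((⋃ θ ∈ Θ, θ.dataset).ncard + 1)) + 1, ?_⟩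
  intro Θ Θ' hΘ _ hle θ' hst
  have hN : ∀ θ ∈ Θ, θ.dataset.ncard ≤ (⋃ θ ∈ Θ, θ.dataset).ncard := fun θ hθ =>
    Set.ncard_le_ncard (Set.subset_biUnion_of_mem (u := fun θ => EConf.dataset θ) hθ)
      (hΘ.biUnion fun θ _ => dataset_finite θ)
  dsimp only
  generalize (⋃ θ ∈ Θ, θ.dataset).ncard = N at hN ⊢
  rcases hst with ⟨θ₁, hθ₁, hst⟩ | ⟨θ₁', h1', θ₂', h2', hst⟩
  · obtain ⟨θ, hθ, f, hf⟩ := hle θ₁ hθ₁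
    have key : ∃ (θ₀ η θ₂ : EConf A B Q S D h) (k : ℕ), simEquiv θ₀ θ ∧ relPow inc k θ₀ η ∧
        k ≤ 8 * (θ.dataset.ncard + 1) ∧ ple θ₂ θ' ∧ anyStep δ η θ₂ := by
      rcases hst with hst | hst | hst
      · exact eps_case hf hst
      · obtain ⟨a, b, c, k, h1, h2, h3, h4, h5⟩ := inc_case hf hst
        exact ⟨a, b, c, k, h1, h2, h3, h4, Or.inr (Or.inl h5)⟩
      · obtain ⟨a, b, c, k, h1, h2, h3, h4, h5⟩ := grow_case hf hst
        exact ⟨a, b, c, k, h1, h2, h3, h4, Or.inr (Or.inr h5)⟩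
    obtain ⟨θ₀, η, θ₂, k, h1, h2, h3, h4, h5⟩ := key
    refine ⟨θ₂, 0 + 1 + k, h4, ?_, ?_⟩
    · have := hN θ hθ
      have h6 : k ≤ 8 * (N + 1) := by omega
      exact le_trans (by omega) (Nat.add_le_add_right (Nat.le_add_right (8 * (N + 1)) _) 1)
    · exact derives_cut (a := θ₀) (b := η) ⟨θ, hθ, h1⟩ h2
        (.base (Or.inl ⟨η, Or.inr rfl, h5⟩))
  · obtain ⟨θ₁, h1, f₁, hf₁⟩ := hle θ₁' h1'
    obtain ⟨θ₂, h2, f₂, hf₂⟩ := hle θ₂' h2'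
    obtain ⟨a₁, a₂, η₁, η₂, ζ, k₁, k₂, s1, s2, p1, p2, b1, b2, hp, hm⟩ :=
      merge_case hf₁ hf₂ hst
    refine ⟨ζ, 0 + 1 + k₂ + k₁, hp, ?_, ?_⟩
    · have hmul := Nat.mul_le_mul (Nat.add_le_add_right (hN θ₁ h1) 1)
        (Nat.add_le_add_right (hN θ₂ h2) 1)
      have c1 := b1.trans (Nat.mul_le_mul_left 2 hmul)
      have c2 := b2.trans (Nat.mul_le_mul_left 2 hmul)
      linarith
    · refine derives_cut (a := a₁) (b := η₁) ⟨θ₁, h1, s1⟩ p1 ?_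
      refine derives_cut (a := a₂) (b := η₂) (Or.inl ⟨θ₂, h2, s2⟩) p2 ?_
      exact .base (Or.inr ⟨η₁, Or.inl (Or.inr rfl), η₂, Or.inr rfl, hm⟩)

end ECBUDA
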